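/- arXiv:2408.02550 — 3 statements merged into one kernel-verified Lean document; each statement's English description precedes it below -/
import Mathlib

section
/- Let Y and Z be jointly distributed finite-valued random variables. Then there exist random variables U1, U2, U3 adjoinable to (Y,Z) such that TRIPLE(Y,U1,U2) and TRIPLE(Z,U1,U3) hold, if and only if Y and Z are both uniform over their supports and their supports have the same cardinality. -/
namespace CIPaper

/-- A bundled probability space. -/
structure ProbSpace where
  carrier : Type
  [inst : MeasurableSpace carrier]
  μ : MeasureTheory.Measure carrier
  [isProb : MeasureTheory.IsProbabilityMeasure μ]

attribute [instance] ProbSpace.inst ProbSpace.isProb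

/-- A bundled finite measurable alphabet, used as value space of auxiliary random variables. -/
structure FinAlphabet where
  carrier : Type
  [fin : Fintype carrier]
  [ms : MeasurableSpace carrier]
  [msc : MeasurableSingletonClass carrier]

attribute [instance] FinAlphabet.fin FinAlphabet.ms FinAlphabet.msc

open MeasureTheory ProbabilityTheory Real

variable {Ω : Type*} [MeasurableSpace Ω] {S T U : Type*}

/-- P(X = x). -/
noncomputable def pr (μ : Measure Ω) (X : Ω → S) (x : S) : ℝ :=
  (μ (X ⁻¹' {x})).toReal

/-- Shannon entropy (base 2) of a finite-valued random variable. -/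
noncomputable def ent (μ : Measure Ω) [Fintype S] (X : Ω → S) : ℝ :=
  (∑ x, Real.negMulLog (pr μ X x)) / Real.log 2

/-- Conditional entropy H(X|Y). -/
noncomputable def condEnt (μ : Measure Ω) [Fintype S] [Fintype T]
    (X : Ω → S) (Y : Ω → T) : ℝ :=
  ent μ (fun ω => (X ω, Y ω)) - ent μ Y

/-- Mutual information I(X;Y). -/
noncomputable def mi (μ : Measure Ω) [Fintype S] [Fintype T]
    (X : Ω → S) (Y : Ω → T) : ℝ :=
  ent μ X + ent μ Y - ent μ (fun ω => (X ω, Y ω))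

/-- Conditional mutual information I(X;Y|Z). -/
noncomputable def cmi (μ : Measure Ω) [Fintype S] [Fintype T] [Fintype U]
    (X : Ω → S) (Y : Ω → T) (Z : Ω → U) : ℝ :=
  ent μ (fun ω => (X ω, Z ω)) + ent μ (fun ω => (Y ω, Z ω))
    - ent μ (fun ω => (X ω, (Y ω, Z ω))) - ent μ Z

/-- The support of a random variable: values of positive probability. -/
def support (μ : Measure Ω) (X : Ω → S) : Set S := {x | 0 < pr μ X x}

/-- X is uniformly distributed over its support. -/
def IsUniform (μ : Measure Ω) (X : Ω → S) : Prop :=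
  ∀ x ∈ support μ X, ∀ y ∈ support μ X, pr μ X x = pr μ X y

/-- X is uniformly distributed over a support of size n. -/
def UniformOn (μ : Measure Ω) (X : Ω → S) (n : ℕ) : Prop :=
  IsUniform μ X ∧ (support μ X).ncard = n

/-- The TRIPLE predicate: pairwise independence plus each variable a function of the
other two. -/
def TRIPLE (μ : Measure Ω) [Fintype S] [Fintype T] [Fintype U]
    (X : Ω → S) (Y : Ω → T) (Z : Ω → U) : Prop :=
  condEnt μ X (fun ω => (Y ω, Z ω)) = 0 ∧ condEnt μ Y (fun ω => (X ω, Z ω)) = 0 ∧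
    condEnt μ Z (fun ω => (X ω, Y ω)) = 0 ∧
    mi μ X Y = 0 ∧ mi μ X Z = 0 ∧ mi μ Y Z = 0

end CIPaper

namespace CIPaper

open MeasureTheory ProbabilityTheory Real

section Entropy

variable {Ω S T U : Type*} [MeasurableSpace Ω] {μ : Measure Ω}

lemma pr_nonneg (X : Ω → S) (x : S) : 0 ≤ pr μ X x := ENNReal.toReal_nonneg

lemma pr_congr_ae {X : Ω → S} {W : Ω → T} {x : S} {w : T}
    (h : ∀ᵐ ω ∂μ, X ω = x ↔ W ω = w) : pr μ X x = pr μ W w := by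
  unfold pr
  congr 1
  apply measure_congr
  filter_upwards [h] with ω hω
  exact propext hω

lemma pr_congr {X : Ω → S} {W : Ω → T} {x : S} {w : T}
    (h : ∀ ω, X ω = x ↔ W ω = w) : pr μ X x = pr μ W w :=
  pr_congr_ae (ae_of_all _ h)

lemma ae_mem_support [Finite S] [IsFiniteMeasure μ] (X : Ω → S) :
    ∀ᵐ ω ∂μ, X ω ∈ support μ X := by
  have h : ∀ x : S, ∀ᵐ ω ∂μ, X ω = x → x ∈ support μ X := by
    intro x
    by_cases hx : x ∈ support μ X
    · exact ae_of_all _ fun _ _ => hx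
    · have h0 : pr μ X x = 0 := le_antisymm (not_lt.mp hx) (pr_nonneg X x)
      have h1 : μ (X ⁻¹' {x}) = 0 :=
        ((ENNReal.toReal_eq_zero_iff _).mp h0).resolve_right (measure_ne_top _ _)
      filter_upwards [measure_eq_zero_iff_ae_notMem.mp h1] with ω hω hxω
      exact absurd hxω hω
  filter_upwards [ae_all_iff.mpr h] with ω hω
  exact hω _ rfl

/-- Encoding of a uniform variable with support of size `n` as an element of `ZMod n`. -/
lemma exists_encoding [Fintype S] {X : Ω → S} {n : ℕ}
    (hn : (support μ X).ncard = n) [NeZero n] :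
    ∃ (f : S → ZMod n) (g : ZMod n → S),
      (∀ t, f (g t) = t) ∧ (∀ t, g t ∈ support μ X) ∧ ∀ x ∈ support μ X, g (f x) = x := by
  classical
  have hcard : Fintype.card (support μ X) = Fintype.card (ZMod n) := by
    rw [ZMod.card, ← hn, Set.ncard_eq_toFinset_card', Set.toFinset_card]
  let e := Fintype.equivOfCardEq hcard
  refine ⟨fun x => if h : x ∈ support μ X then e ⟨x, h⟩ else 0, fun t => e.symm t,
    fun t => ?_, fun t => (e.symm t).2, fun x hx => ?_⟩
  · simp
  · simp [hx]

variable [MeasurableSpace S] [MeasurableSingletonClass S]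
  [MeasurableSpace T] [MeasurableSingletonClass T]
  [MeasurableSpace U] [MeasurableSingletonClass U]

lemma pr_eq_of_identDistrib {Ω' : Type*} [MeasurableSpace Ω'] {ν : Measure Ω'}
    {X : Ω → S} {X' : Ω' → S} (h : IdentDistrib X X' μ ν) (x : S) :
    pr μ X x = pr ν X' x := by
  unfold pr
  rw [h.measure_preimage_eq (measurableSet_singleton x)]

lemma sum_pr_prod_left [Fintype S] [IsFiniteMeasure μ] {X : Ω → S} {W : Ω → T}
    (hX : Measurable X) (hW : Measurable W) (w : T) :
    ∑ x, pr μ (fun ω => (X ω, W ω)) (x, w) = pr μ W w := by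
  have h : W ⁻¹' {w} = ⋃ x ∈ Finset.univ, (fun ω => (X ω, W ω)) ⁻¹' {(x, w)} := by
    ext ω; simp
  change _ = μ.real (W ⁻¹' {w})
  rw [h, measureReal_biUnion_finset]
  · rfl
  · intro x _ x' _ hne
    refine Set.disjoint_left.mpr fun ω h₁ h₂ => hne ?_
    simp only [Set.mem_preimage, Set.mem_singleton_iff, Prod.mk.injEq] at h₁ h₂
    exact h₁.1.symm.trans h₂.1
  · exact fun x _ => (hX.prodMk hW) (measurableSet_singleton _)

lemma sum_pr_prod_right [Fintype T] [IsFiniteMeasure μ] {X : Ω → S} {W : Ω → T}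
    (hX : Measurable X) (hW : Measurable W) (x : S) :
    ∑ w, pr μ (fun ω => (X ω, W ω)) (x, w) = pr μ X x := by
  rw [← sum_pr_prod_left hW hX x]
  exact Finset.sum_congr rfl fun w _ => pr_congr fun ω => by simp [and_comm]

lemma sum_pr [Fintype S] [IsProbabilityMeasure μ] {X : Ω → S} (hX : Measurable X) :
    ∑ x, pr μ X x = 1 := by
  have h := sum_pr_prod_left (μ := μ) hX (measurable_const (a := ())) ()
  have h1 : pr μ (fun _ => ()) () = 1 := by simp [pr]
  rw [← h1, ← h]
  exact Finset.sum_congr rfl fun x _ => pr_congr fun ω => by simp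

lemma pr_prod_le_right [Fintype S] [IsFiniteMeasure μ] {X : Ω → S} {W : Ω → T}
    (hX : Measurable X) (hW : Measurable W) (x : S) (w : T) :
    pr μ (fun ω => (X ω, W ω)) (x, w) ≤ pr μ W w := by
  rw [← sum_pr_prod_left hX hW w]
  exact Finset.single_le_sum (f := fun x => pr μ (fun ω => (X ω, W ω)) (x, w))
    (fun _ _ => pr_nonneg _ _) (Finset.mem_univ x)

lemma pr_prod_le_left [Fintype T] [IsFiniteMeasure μ] {X : Ω → S} {W : Ω → T}
    (hX : Measurable X) (hW : Measurable W) (x : S) (w : T) :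
    pr μ (fun ω => (X ω, W ω)) (x, w) ≤ pr μ X x := by
  rw [← sum_pr_prod_right hX hW x]
  exact Finset.single_le_sum (f := fun w => pr μ (fun ω => (X ω, W ω)) (x, w))
    (fun _ _ => pr_nonneg _ _) (Finset.mem_univ w)

variable [Fintype S] [Fintype T] [Fintype U]

lemma condEnt_eq_zero_iff [IsFiniteMeasure μ] {X : Ω → S} {W : Ω → T}
    (hX : Measurable X) (hW : Measurable W) :
    condEnt μ X W = 0 ↔ ∀ x w, pr μ (fun ω => (X ω, W ω)) (x, w) = 0 ∨
      pr μ (fun ω => (X ω, W ω)) (x, w) = pr μ W w := by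
  set p : S × T → ℝ := pr μ (fun ω => (X ω, W ω)) with hp
  have hsum : condEnt μ X W =
      (∑ q : S × T, p q * (log (pr μ W q.2) - log (p q))) / log 2 := by
    have hw : ∑ w, negMulLog (pr μ W w) = ∑ q : S × T, -(p q * log (pr μ W q.2)) := by
      rw [Fintype.sum_prod_type_right]
      refine Finset.sum_congr rfl fun w _ => ?_
      dsimp only
      rw [Finset.sum_neg_distrib, ← Finset.sum_mul, hp, sum_pr_prod_left hX hW, negMulLog,
        neg_mul]
    unfold condEnt ent
    rw [hw, ← sub_div, ← Finset.sum_sub_distrib]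
    congr 1
    refine Finset.sum_congr rfl fun q _ => ?_
    rw [negMulLog]
    ring
  have hlog : log 2 ≠ 0 := (log_pos one_lt_two).ne'
  have hnn : ∀ q ∈ Finset.univ, 0 ≤ p q * (log (pr μ W q.2) - log (p q)) := by
    rintro ⟨x, w⟩ -
    have h0 : 0 ≤ p (x, w) := pr_nonneg _ _
    rcases h0.eq_or_lt with h | h
    · simp [← h]
    · exact mul_nonneg h.le (sub_nonneg.mpr (log_le_log h (pr_prod_le_right hX hW x w)))
  rw [hsum, div_eq_zero_iff, or_iff_left hlog, Finset.sum_eq_zero_iff_of_nonneg hnn]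
  constructor
  · intro h x w
    rcases mul_eq_zero.mp (h (x, w) (Finset.mem_univ _)) with h0 | h0
    · exact Or.inl h0
    · rcases (pr_nonneg _ _ : 0 ≤ p (x, w)).eq_or_lt with h1 | h1
      · exact Or.inl h1.symm
      · exact Or.inr (log_injOn_pos h1 (h1.trans_le (pr_prod_le_right hX hW x w))
          (sub_eq_zero.mp h0).symm)
  · rintro h ⟨x, w⟩ -
    rcases h x w with h0 | h0 <;> simp [h0]

lemma gibbs_term {p a b : ℝ} (hp : 0 ≤ p) (hpa : p ≤ a) (hpb : p ≤ b) :
    0 ≤ p * (log p - log a - log b) - p + a * b ∧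
      (p * (log p - log a - log b) - p + a * b = 0 ↔ p = a * b) := by
  rcases hp.eq_or_lt with rfl | hp
  · simp only [zero_mul, sub_zero, zero_add]
    exact ⟨mul_nonneg hpa hpb, eq_comm⟩
  have ha := hp.trans_le hpa
  have hb := hp.trans_le hpb
  have hq : 0 < a * b / p := by positivity
  have hlog : log (a * b / p) = log a + log b - log p := by
    rw [log_div (by positivity) hp.ne', log_mul ha.ne' hb.ne']
  have hterm : p * (log p - log a - log b) - p + a * b =
      p * (a * b / p - 1 - log (a * b / p)) := by
    rw [hlog]
    field_simp
    ring
  rw [hterm]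
  refine ⟨mul_nonneg hp.le (sub_nonneg.mpr (log_le_sub_one_of_pos hq)), fun h => ?_, fun h => ?_⟩
  · by_contra hne
    have hne1 : a * b / p ≠ 1 := fun h1 => hne ((div_eq_one_iff_eq hp.ne').mp h1).symm
    exact (mul_pos hp (sub_pos.mpr (log_lt_sub_one_of_pos hq hne1))).ne' h
  · rw [← h, div_self hp.ne']
    simp

lemma mi_eq_zero_iff [IsProbabilityMeasure μ] {X : Ω → S} {W : Ω → T}
    (hX : Measurable X) (hW : Measurable W) :
    mi μ X W = 0 ↔ ∀ x w, pr μ (fun ω => (X ω, W ω)) (x, w) = pr μ X x * pr μ W w := by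
  set p : S × T → ℝ := pr μ (fun ω => (X ω, W ω)) with hp
  have hsum : mi μ X W = (∑ q : S × T, (p q * (log (p q) - log (pr μ X q.1) - log (pr μ W q.2))
      - p q + pr μ X q.1 * pr μ W q.2)) / log 2 := by
    have hx : ∑ x, negMulLog (pr μ X x) = ∑ q : S × T, -(p q * log (pr μ X q.1)) := by
      rw [Fintype.sum_prod_type]
      refine Finset.sum_congr rfl fun x _ => ?_
      dsimp only
      rw [Finset.sum_neg_distrib, ← Finset.sum_mul, hp, sum_pr_prod_right hX hW, negMulLog,
        neg_mul]
    have hw : ∑ w, negMulLog (pr μ W w) = ∑ q : S × T, -(p q * log (pr μ W q.2)) := by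
      rw [Fintype.sum_prod_type_right]
      refine Finset.sum_congr rfl fun w _ => ?_
      dsimp only
      rw [Finset.sum_neg_distrib, ← Finset.sum_mul, hp, sum_pr_prod_left hX hW, negMulLog,
        neg_mul]
    have h1 : ∑ q : S × T, p q = 1 := sum_pr (hX.prodMk hW)
    have h2 : ∑ q : S × T, pr μ X q.1 * pr μ W q.2 = 1 := by
      rw [Fintype.sum_prod_type, ← Finset.sum_mul_sum, sum_pr hX, sum_pr hW, one_mul]
    unfold mi ent
    rw [hx, hw, Finset.sum_add_distrib, Finset.sum_sub_distrib, h1, h2, sub_add_cancel,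
      ← add_div, ← sub_div, ← Finset.sum_add_distrib, ← Finset.sum_sub_distrib]
    congr 1
    refine Finset.sum_congr rfl fun q _ => ?_
    rw [negMulLog]
    ring
  have hlog : log 2 ≠ 0 := (log_pos one_lt_two).ne'
  have hg (q : S × T) := gibbs_term (pr_nonneg _ _ : 0 ≤ p q)
    (pr_prod_le_left hX hW q.1 q.2) (pr_prod_le_right hX hW q.1 q.2)
  rw [hsum, div_eq_zero_iff, or_iff_left hlog,
    Finset.sum_eq_zero_iff_of_nonneg fun q _ => (hg q).1]
  exact ⟨fun h x w => (hg (x, w)).2.mp (h (x, w) (Finset.mem_univ _)),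
    fun h q _ => (hg q).2.mpr (h q.1 q.2)⟩

lemma condEnt_eq_zero_of_ae_eq [IsFiniteMeasure μ] {X : Ω → S} {W : Ω → T}
    (hX : Measurable X) (hW : Measurable W) (f : T → S) (h : ∀ᵐ ω ∂μ, X ω = f (W ω)) :
    condEnt μ X W = 0 := by
  rw [condEnt_eq_zero_iff hX hW]
  intro x w
  by_cases hx : x = f w
  · right
    refine pr_congr_ae ?_
    filter_upwards [h] with ω hω
    rw [Prod.mk.injEq, hω, hx]
    exact ⟨fun h => h.2, fun h => ⟨by rw [h], h⟩⟩
  · left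
    have : μ ((fun ω => (X ω, W ω)) ⁻¹' {(x, w)}) = 0 := by
      refine measure_mono_null (fun ω hω => ?_) (ae_iff.mp h)
      simp only [Set.mem_preimage, Set.mem_singleton_iff, Prod.mk.injEq] at hω
      rw [Set.mem_ofPred_eq, hω.1, hω.2]
      exact hx
    simp [pr, this]

lemma pr_eq_of_TRIPLE [IsProbabilityMeasure μ] {X : Ω → S} {Y : Ω → T} {Z : Ω → U}
    (hX : Measurable X) (hY : Measurable Y) (hZ : Measurable Z) (h : TRIPLE μ X Y Z)
    {x : S} {y : T} (hx : x ∈ support μ X) (hy : y ∈ support μ Y) :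
    pr μ X x = pr μ Y y := by
  obtain ⟨h₁, h₂, h₃, h₄, h₅, h₆⟩ := h
  rw [condEnt_eq_zero_iff hX (hY.prodMk hZ)] at h₁
  rw [condEnt_eq_zero_iff hY (hX.prodMk hZ)] at h₂
  rw [condEnt_eq_zero_iff hZ (hX.prodMk hY)] at h₃
  rw [mi_eq_zero_iff hX hY] at h₄
  rw [mi_eq_zero_iff hX hZ] at h₅
  rw [mi_eq_zero_iff hY hZ] at h₆
  have hx0 : 0 < pr μ X x := hx
  have hy0 : 0 < pr μ Y y := hy
  have hxy := mul_pos hx0 hy0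
  rw [← h₄, ← sum_pr_prod_left hZ (hX.prodMk hY)] at hxy
  obtain ⟨z, -, hz⟩ := Finset.exists_ne_zero_of_sum_ne_zero hxy.ne'
  have e₁ : pr μ (fun ω => (X ω, (Y ω, Z ω))) (x, (y, z)) =
      pr μ (fun ω => (Z ω, (X ω, Y ω))) (z, (x, y)) :=
    pr_congr fun ω => by simp only [Prod.mk.injEq]; tauto
  have e₂ : pr μ (fun ω => (Y ω, (X ω, Z ω))) (y, (x, z)) =
      pr μ (fun ω => (Z ω, (X ω, Y ω))) (z, (x, y)) :=
    pr_congr fun ω => by simp only [Prod.mk.injEq]; tauto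
  have k₁ := (h₁ x (y, z)).resolve_left (e₁ ▸ hz)
  have k₂ := (h₂ y (x, z)).resolve_left (e₂ ▸ hz)
  have k₃ := (h₃ z (x, y)).resolve_left hz
  rw [e₁, h₆] at k₁
  rw [e₂, h₅] at k₂
  rw [h₄] at k₃
  have hxz : pr μ X x = pr μ Z z := mul_right_cancel₀ hy0.ne' (by linarith)
  have hyz : pr μ Y y = pr μ Z z := mul_left_cancel₀ hx0.ne' (by linarith)
  rw [hxz, hyz]

lemma support_nonempty [IsProbabilityMeasure μ] {X : Ω → S} (hX : Measurable X) :
    (support μ X).Nonempty := by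
  obtain ⟨x, -, hx⟩ := Finset.exists_ne_zero_of_sum_ne_zero
    ((sum_pr (μ := μ) hX).trans_ne one_ne_zero)
  exact ⟨x, (pr_nonneg X x).lt_of_ne' hx⟩

lemma ncard_support_mul [IsProbabilityMeasure μ] {X : Ω → S} (hX : Measurable X) {c : ℝ}
    (h : ∀ x ∈ support μ X, pr μ X x = c) : ((support μ X).ncard : ℝ) * c = 1 := by
  classical
  rw [← sum_pr (μ := μ) hX, Set.ncard_eq_toFinset_card', ← nsmul_eq_mul, ← Finset.sum_const]
  have hs : ∑ x ∈ (support μ X).toFinset, c = ∑ x ∈ (support μ X).toFinset, pr μ X x :=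
    Finset.sum_congr rfl fun x hx => (h x (Set.mem_toFinset.mp hx)).symm
  rw [hs]
  refine Finset.sum_subset (Finset.subset_univ _) fun x _ hx => ?_
  by_contra hne
  exact hx (Set.mem_toFinset.mpr ((pr_nonneg X x).lt_of_ne' hne))

lemma mi_eq_zero_of_pr_prod_eq_mul_const [IsProbabilityMeasure μ] {X : Ω → S} {W : Ω → T}
    (hX : Measurable X) (hW : Measurable W) {c : ℝ}
    (h : ∀ x w, pr μ (fun ω => (X ω, W ω)) (x, w) = pr μ X x * c) : mi μ X W = 0 := by
  rw [mi_eq_zero_iff hX hW]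
  intro x w
  rw [h, ← sum_pr_prod_left hX hW w]
  simp_rw [h]
  rw [← Finset.sum_mul, sum_pr hX, one_mul]

/-- A uniform variable masked by an independent uniform key from a group of the same size. -/
lemma TRIPLE_add_key [IsProbabilityMeasure μ] [AddCommGroup T] {A : Ω → S} {K : Ω → T}
    (hA : Measurable A) (hK : Measurable K) {c : ℝ} (f : S → T) (g : T → S)
    (hfg : ∀ t, f (g t) = t) (hgf : ∀ᵐ ω ∂μ, g (f (A ω)) = A ω)
    (hg : ∀ t, pr μ A (g t) = c)
    (hAK : ∀ a k, pr μ (fun ω => (A ω, K ω)) (a, k) = pr μ A a * c) :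
    TRIPLE μ A K (fun ω => f (A ω) + K ω) := by
  have hV : Measurable (fun ω => f (A ω) + K ω) :=
    (Measurable.of_discrete (f := fun q : S × T => f q.1 + q.2)).comp (hA.prodMk hK)
  have hKpr (k : T) : pr μ K k = c := by
    rw [← sum_pr_prod_left hA hK k]
    simp_rw [hAK]
    rw [← Finset.sum_mul, sum_pr hA, one_mul]
  refine ⟨condEnt_eq_zero_of_ae_eq hA (hK.prodMk hV) (fun q => g (q.2 - q.1)) ?_,
    condEnt_eq_zero_of_ae_eq hK (hA.prodMk hV) (fun q => q.2 - f q.1) ?_,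
    condEnt_eq_zero_of_ae_eq hV (hA.prodMk hK) (fun q => f q.1 + q.2) ?_,
    mi_eq_zero_of_pr_prod_eq_mul_const hA hK hAK,
    mi_eq_zero_of_pr_prod_eq_mul_const hA hV (c := c) fun a v => ?_,
    mi_eq_zero_of_pr_prod_eq_mul_const hK hV (c := c) fun k v => ?_⟩
  · filter_upwards [hgf] with ω hω
    simp [hω]
  · exact ae_of_all _ fun ω => by simp
  · exact ae_of_all _ fun ω => rfl
  · rw [← hAK a (v - f a)]
    refine pr_congr fun ω => ?_
    simp only [Prod.mk.injEq]
    refine and_congr_right fun h => ?_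
    rw [h, eq_sub_iff_add_eq']
  · rw [hKpr]
    nth_rewrite 1 [← hg (v - k)]
    rw [← hAK (g (v - k)) k]
    refine pr_congr_ae ?_
    filter_upwards [hgf] with ω hω
    simp only [Prod.mk.injEq]
    rw [and_comm]
    refine and_congr_left fun h => ?_
    rw [h, ← eq_sub_iff_add_eq]
    exact ⟨fun h' => by rw [← h', hω], fun h' => by rw [h', hfg]⟩

/-- A uniform variable with support of size `n` and an independent uniform key in `ZMod n`
complete to a triple. -/
lemma exists_TRIPLE_of_isUniform [IsProbabilityMeasure μ] {n : ℕ} [NeZero n]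
    [MeasurableSpace (ZMod n)] [MeasurableSingletonClass (ZMod n)] {A : Ω → S} {K : Ω → ZMod n}
    (hA : Measurable A) (hK : Measurable K) (hU : IsUniform μ A)
    (hn : (support μ A).ncard = n)
    (hind : ∀ a k, μ.real (A ⁻¹' {a} ∩ K ⁻¹' {k}) = μ.real (A ⁻¹' {a}) * (n : ℝ)⁻¹) :
    ∃ V : Ω → ZMod n, Measurable V ∧ TRIPLE μ A K V := by
  obtain ⟨f, g, hfg, hg, hgf⟩ := exists_encoding (μ := μ) hn
  refine ⟨fun ω => f (A ω) + K ω,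
    (Measurable.of_discrete (f := fun q : S × ZMod n => f q.1 + q.2)).comp (hA.prodMk hK),
    TRIPLE_add_key hA hK (c := (n : ℝ)⁻¹) f g hfg ?_ (fun t => ?_) fun a k => ?_⟩
  · filter_upwards [ae_mem_support A] with ω hω using hgf _ hω
  · rw [← hn]
    exact eq_inv_of_mul_eq_one_right
      (ncard_support_mul hA fun x hx => hU x hx _ (hg t))
  · change _ = μ.real (A ⁻¹' {a}) * _
    rw [← hind]
    change μ.real _ = _
    have hpre : (fun ω => (A ω, K ω)) ⁻¹' {(a, k)} = A ⁻¹' {a} ∩ K ⁻¹' {k} := by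
      ext ω
      simp
    rw [hpre]

/-- A finite-valued variable can be realized, on a product with a finite probability space in
`Type`, jointly with an independent uniform key. -/
lemma exists_adjoin_uniform [IsProbabilityMeasure μ] {X : Ω → S} (hX : Measurable X)
    (n : ℕ) [NeZero n] [MeasurableSpace (ZMod n)] [MeasurableSingletonClass (ZMod n)] :
    ∃ (P : ProbSpace) (X' : P.carrier → S) (K : P.carrier → ZMod n),
      Measurable X' ∧ Measurable K ∧ IdentDistrib X X' μ P.μ ∧
      ∀ (B : Set S) (k : ZMod n), P.μ.real (X' ⁻¹' B ∩ K ⁻¹' {k}) =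
        P.μ.real (X' ⁻¹' B) * (n : ℝ)⁻¹ := by
  classical
  let e := Fintype.equivFin S
  have he : Measurable e := Measurable.of_discrete
  have : IsProbabilityMeasure (μ.map (fun ω => e (X ω))) :=
    Measure.isProbabilityMeasure_map (he.comp hX).aemeasurable
  let κ : Measure (ZMod n) := (PMF.uniformOfFintype (ZMod n)).toMeasure
  let ρ : Measure (Fin (Fintype.card S) × ZMod n) := (μ.map (fun ω => e (X ω))).prod κ
  have hX' : Measurable (fun q : Fin (Fintype.card S) × ZMod n => e.symm q.1) :=
    Measurable.of_discrete
  have hκ (k : ZMod n) : κ.real {k} = (n : ℝ)⁻¹ := by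
    simp only [κ, Measure.real]
    rw [PMF.toMeasure_apply_singleton _ _ (measurableSet_singleton k)]
    simp [ZMod.card]
  refine ⟨⟨Fin (Fintype.card S) × ZMod n, ρ⟩, fun q => e.symm q.1, Prod.snd, hX',
    measurable_snd, ⟨hX.aemeasurable, hX'.aemeasurable, ?_⟩, fun B k => ?_⟩
  · have hm : Measurable e.symm := Measurable.of_discrete
    change μ.map X = ρ.map (e.symm ∘ Prod.fst)
    rw [← Measure.map_map hm measurable_fst]
    change _ = (ρ.fst).map e.symm
    have hcomp : X = e.symm ∘ fun ω => e (X ω) := by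
      ext ω
      simp
    rw [Measure.fst_prod, Measure.map_map hm (he.fun_comp hX), ← hcomp]
  · have h₁ : (fun q : Fin (Fintype.card S) × ZMod n => e.symm q.1) ⁻¹' B ∩ Prod.snd ⁻¹' {k} =
        (e.symm ⁻¹' B) ×ˢ {k} := by
      ext; simp
    have h₂ : (fun q : Fin (Fintype.card S) × ZMod n => e.symm q.1) ⁻¹' B =
        (e.symm ⁻¹' B) ×ˢ Set.univ := by
      ext; simp
    rw [h₁, h₂, measureReal_prod_prod, measureReal_prod_prod, hκ]
    simp

end Entropy

/-- U₁, U₂, U₃ with TRIPLE(Y,U₁,U₂) and TRIPLE(Z,U₁,U₃) can be adjoined to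
(Y,Z) iff Y and Z are both uniform and their supports have the same cardinality. -/
theorem stmt_12 {Ω : Type*} [MeasurableSpace Ω] (μ : Measure Ω) [IsProbabilityMeasure μ]
    {SY SZ : Type*} [Fintype SY] [Fintype SZ]
    [MeasurableSpace SY] [MeasurableSingletonClass SY]
    [MeasurableSpace SZ] [MeasurableSingletonClass SZ]
    (Y : Ω → SY) (Z : Ω → SZ) (hY : Measurable Y) (hZ : Measurable Z) :
    (∃ (P : ProbSpace) (Y' : P.carrier → SY) (Z' : P.carrier → SZ)
      (T₁ T₂ T₃ : FinAlphabet) (U₁ : P.carrier → T₁.carrier)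
      (U₂ : P.carrier → T₂.carrier) (U₃ : P.carrier → T₃.carrier),
      Measurable Y' ∧ Measurable Z' ∧ Measurable U₁ ∧ Measurable U₂ ∧ Measurable U₃ ∧
      IdentDistrib (fun ω => (Y ω, Z ω)) (fun ω => (Y' ω, Z' ω)) μ P.μ ∧
      TRIPLE P.μ Y' U₁ U₂ ∧ TRIPLE P.μ Z' U₁ U₃) ↔
    (IsUniform μ Y ∧ IsUniform μ Z ∧ (support μ Y).ncard = (support μ Z).ncard) := by
  constructor
  · rintro ⟨P, Y', Z', T₁, T₂, T₃, U₁, U₂, U₃, hY', hZ', hU₁, hU₂, hU₃, hid, hTY, hTZ⟩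
    have hprY : pr μ Y = pr P.μ Y' := funext (pr_eq_of_identDistrib (hid.comp measurable_fst))
    have hprZ : pr μ Z = pr P.μ Z' := funext (pr_eq_of_identDistrib (hid.comp measurable_snd))
    obtain ⟨u, hu⟩ := support_nonempty (μ := P.μ) hU₁
    have hYc : ∀ y ∈ support μ Y, pr μ Y y = pr P.μ U₁ u := by
      unfold support
      rw [hprY]
      exact fun y hy => pr_eq_of_TRIPLE hY' hU₁ hU₂ hTY hy hu
    have hZc : ∀ z ∈ support μ Z, pr μ Z z = pr P.μ U₁ u := by
      unfold support
      rw [hprZ]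
      exact fun z hz => pr_eq_of_TRIPLE hZ' hU₁ hU₃ hTZ hz hu
    refine ⟨fun x hx y hy => (hYc x hx).trans (hYc y hy).symm,
      fun x hx y hy => (hZc x hx).trans (hZc y hy).symm, ?_⟩
    have hu0 : pr P.μ U₁ u ≠ 0 := ne_of_gt hu
    exact_mod_cast mul_right_cancel₀ hu0
      ((ncard_support_mul hY hYc).trans (ncard_support_mul hZ hZc).symm)
  · rintro ⟨hUY, hUZ, hcard⟩
    obtain ⟨n, hn⟩ : ∃ n, (support μ Y).ncard = n := ⟨_, rfl⟩
    have hn' : (support μ Z).ncard = n := hcard.symm.trans hn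
    have : NeZero n := ⟨by
      rw [← hn]
      exact ((Set.ncard_pos (Set.toFinite _)).mpr (support_nonempty hY)).ne'⟩
    let _ : MeasurableSpace (ZMod n) := ⊤
    have : MeasurableSingletonClass (ZMod n) := ⟨fun _ => trivial⟩
    obtain ⟨P, X', K, hX', hK, hid, hind⟩ := exists_adjoin_uniform (μ := μ) (hY.prodMk hZ) n
    have hprY : pr μ Y = pr P.μ (fun ω => (X' ω).1) :=
      funext (pr_eq_of_identDistrib (hid.comp measurable_fst))
    have hprZ : pr μ Z = pr P.μ (fun ω => (X' ω).2) :=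
      funext (pr_eq_of_identDistrib (hid.comp measurable_snd))
    unfold IsUniform support at hUY hUZ
    unfold support at hn hn'
    rw [hprY] at hUY hn
    rw [hprZ] at hUZ hn'
    obtain ⟨V, hV, hTY⟩ := exists_TRIPLE_of_isUniform (measurable_fst.comp hX') hK hUY hn
      fun y k => hind (Prod.fst ⁻¹' {y}) k
    obtain ⟨W, hW, hTZ⟩ := exists_TRIPLE_of_isUniform (measurable_snd.comp hX') hK hUZ hn'
      fun z k => hind (Prod.snd ⁻¹' {z}) k
    exact ⟨P, fun ω => (X' ω).1, fun ω => (X' ω).2, ⟨ZMod n⟩, ⟨ZMod n⟩, ⟨ZMod n⟩, K, V, W,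
      measurable_fst.comp hX', measurable_snd.comp hX', hK, hV, hW, hid, hTY, hTZ⟩

end CIPaper
end

section
/- Let k ≥ 2 be an integer and let p, q, p', q' be positive integers satisfying (k−1)^q < 2^p < k^q and k^{q'} < 2^{p'} < (k+1)^{q'}. Then for every positive integer i, the two inequalities 2^p ≤ i^q and i^{q'} ≤ 2^{p'} hold simultaneously if and only if i = k. -/
/-- if (k−1)^q < 2^p < k^q and k^q' < 2^p' < (k+1)^q', then for every
positive integer i, (2^p ≤ i^q and i^q' ≤ 2^p') hold simultaneously iff i = k. -/
theorem stmt_15 (k p q p' q' : ℕ) (hk : 2 ≤ k)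
    (hp : 0 < p) (hq : 0 < q) (hp' : 0 < p') (hq' : 0 < q')
    (h1 : (k - 1) ^ q < 2 ^ p) (h2 : 2 ^ p < k ^ q)
    (h3 : k ^ q' < 2 ^ p') (h4 : 2 ^ p' < (k + 1) ^ q') :
    ∀ i : ℕ, 0 < i → ((2 ^ p ≤ i ^ q ∧ i ^ q' ≤ 2 ^ p') ↔ i = k) := by
  intro i _
  constructor
  · rintro ⟨hl, hu⟩
    have hlt : k - 1 < i := lt_of_pow_lt_pow_left₀ q i.zero_le (h1.trans_le hl)
    have hgt : i < k + 1 := lt_of_pow_lt_pow_left₀ q' (k + 1).zero_le (hu.trans_lt h4)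
    omega
  · rintro rfl
    exact ⟨h2.le, h3.le⟩
end

section
/- Let Y1, Z1, Y2, Z2, X1, X2 be jointly distributed finite-valued random variables such that for both i ∈ {1,2}: I(Yi;Zi|Xi) = 0, H(Xi|Yi) = 0 and H(Xi|Zi) = 0. Then there exist random variables U1, U2 adjoinable to (Y1,Z1,Y2,Z2,X1,X2) satisfying RES3(Y1,Z1,U1), RES3(Z1,U1,U2), RES3(U1,U2,Y2) and RES3(U2,Y2,Z2), if and only if H(X1|X2) = H(X2|X1) = 0. -/
namespace CIPaper

open MeasureTheory ProbabilityTheory Real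

/-- The RES3 predicate: I(A;B|C) = I(B;C|A) = I(C;A|B) = 0. -/
def RES3 {Ω : Type*} [MeasurableSpace Ω] (μ : Measure Ω) {S T U : Type*}
    [Fintype S] [Fintype T] [Fintype U]
    (A : Ω → S) (B : Ω → T) (C : Ω → U) : Prop :=
  cmi μ A B C = 0 ∧ cmi μ B C A = 0 ∧ cmi μ C A B = 0

section Shannon

variable {Ω : Type*} [MeasurableSpace Ω] {μ : Measure Ω} {R S T U : Type*}
  [Fintype R] [Fintype S] [Fintype T] [Fintype U]

/-- Entropy is invariant under an injective relabelling. -/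
theorem ent_comp_of_injective (X : Ω → S) {f : S → T} (hf : Function.Injective f) :
    ent μ (fun ω => f (X ω)) = ent μ X := by
  unfold ent
  congr 1
  symm
  refine Finset.sum_of_injOn f hf.injOn (fun _ _ => Finset.mem_univ _) (fun t _ ht => ?_)
    fun x _ => ?_
  · have : (fun ω => f (X ω)) ⁻¹' {t} = ∅ :=
      Set.eq_empty_of_forall_notMem fun ω hω => ht ⟨X ω, by simp, hω⟩
    simp [pr, this]
  · unfold pr
    congr 3
    ext ω
    simp [hf.eq_iff]

theorem ent_pair_comm (X : Ω → S) (Y : Ω → T) :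
    ent μ (fun ω => (X ω, Y ω)) = ent μ (fun ω => (Y ω, X ω)) :=
  ent_comp_of_injective (fun ω => (Y ω, X ω)) (f := fun p => (p.2, p.1))
    fun _ _ h => Prod.ext (Prod.ext_iff.1 h).2 (Prod.ext_iff.1 h).1

theorem ent_triple_left_comm (X : Ω → S) (Y : Ω → T) (Z : Ω → U) :
    ent μ (fun ω => (X ω, (Y ω, Z ω))) = ent μ (fun ω => (Y ω, (X ω, Z ω))) :=
  ent_comp_of_injective (fun ω => (Y ω, (X ω, Z ω))) (f := fun p => (p.2.1, (p.1, p.2.2)))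
    (by rintro ⟨_, _, _⟩ ⟨_, _, _⟩ h; simp_all)

theorem ent_triple_rotate (X : Ω → S) (Y : Ω → T) (Z : Ω → U) :
    ent μ (fun ω => (X ω, (Y ω, Z ω))) = ent μ (fun ω => (Z ω, (X ω, Y ω))) :=
  ent_comp_of_injective (fun ω => (Z ω, (X ω, Y ω))) (f := fun p => (p.2.1, (p.2.2, p.1)))
    (by rintro ⟨_, _, _⟩ ⟨_, _, _⟩ h; simp_all)

theorem ent_quadruple_rotate (W : Ω → R) (X : Ω → S) (Y : Ω → T) (Z : Ω → U) :
    ent μ (fun ω => (W ω, (X ω, (Y ω, Z ω)))) = ent μ (fun ω => (Z ω, (W ω, (X ω, Y ω)))) :=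
  ent_comp_of_injective (fun ω => (Z ω, (W ω, (X ω, Y ω))))
    (f := fun p => (p.2.1, (p.2.2.1, (p.2.2.2, p.1))))
    (by rintro ⟨_, _, _, _⟩ ⟨_, _, _, _⟩ h; simp_all)

theorem ent_quadruple_swap_right (W : Ω → R) (X : Ω → S) (Y : Ω → T) (Z : Ω → U) :
    ent μ (fun ω => (W ω, (X ω, (Y ω, Z ω)))) = ent μ (fun ω => (W ω, (X ω, (Z ω, Y ω)))) :=
  ent_comp_of_injective (fun ω => (W ω, (X ω, (Z ω, Y ω))))
    (f := fun p => (p.1, (p.2.1, (p.2.2.2, p.2.2.1))))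
    (by rintro ⟨_, _, _, _⟩ ⟨_, _, _, _⟩ h; simp_all)

theorem cmi_comm (A : Ω → R) (B : Ω → S) (C : Ω → T) : cmi μ A B C = cmi μ B A C := by
  unfold cmi
  rw [ent_triple_left_comm A B C]
  ring

theorem condEnt_comp_left {f : S → T} (hf : Function.Injective f) (B : Ω → S) (A : Ω → R) :
    condEnt μ (fun ω => f (B ω)) A = condEnt μ B A := by
  have h := ent_comp_of_injective (μ := μ) (fun ω => (B ω, A ω)) (f := fun p => (f p.1, p.2))
    fun _ _ h => Prod.ext (hf (Prod.ext_iff.1 h).1) (Prod.ext_iff.1 h).2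
  unfold condEnt
  rw [h]

theorem ent_pair_comp_right {f : S → T} (hf : Function.Injective f) (A : Ω → R) (B : Ω → S) :
    ent μ (fun ω => (A ω, f (B ω))) = ent μ (fun ω => (A ω, B ω)) :=
  ent_comp_of_injective (fun ω => (A ω, B ω)) (f := fun p => (p.1, f p.2))
    fun _ _ h => Prod.ext (Prod.ext_iff.1 h).1 (hf (Prod.ext_iff.1 h).2)

theorem condEnt_comp_right {f : S → T} (hf : Function.Injective f) (A : Ω → R) (B : Ω → S) :
    condEnt μ A (fun ω => f (B ω)) = condEnt μ A B := by
  unfold condEnt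
  rw [ent_pair_comp_right hf, ent_comp_of_injective B hf]

theorem cmi_comp_right {f : T → U} (hf : Function.Injective f) (A : Ω → R) (B : Ω → S)
    (C : Ω → T) : cmi μ A B (fun ω => f (C ω)) = cmi μ A B C := by
  have h := ent_pair_comp_right (μ := μ) (f := fun p : S × T => (p.1, f p.2))
    (fun _ _ h => Prod.ext (Prod.ext_iff.1 h).1 (hf (Prod.ext_iff.1 h).2))
    A (fun ω => (B ω, C ω))
  unfold cmi
  rw [h, ent_pair_comp_right hf, ent_pair_comp_right hf, ent_comp_of_injective C hf]

/-- `X` is, up to a null set, the common information of `A` and `B`: a function of each of them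
that renders them conditionally independent. -/
def IsCommonInfo (μ : Measure Ω) (A : Ω → R) (B : Ω → S) (X : Ω → U) : Prop :=
  cmi μ A B X = 0 ∧ condEnt μ X A = 0 ∧ condEnt μ X B = 0

theorem IsCommonInfo.comp {A : Ω → R} {B : Ω → S} {C : Ω → T}
    (h : IsCommonInfo μ A B C) {f : T → U} (hf : Function.Injective f) :
    IsCommonInfo μ A B (fun ω => f (C ω)) := by
  unfold IsCommonInfo
  rw [cmi_comp_right hf, condEnt_comp_left hf, condEnt_comp_left hf]
  exact h

/-- Subadditivity of `negMulLog`-sums for a nonnegative matrix and its marginals. -/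
theorem sum_negMulLog_marginals (q : S → T → ℝ) (hq : ∀ x y, 0 ≤ q x y) :
    ∑ x, ∑ y, negMulLog (q x y) + negMulLog (∑ x, ∑ y, q x y) ≤
      ∑ x, negMulLog (∑ y, q x y) + ∑ y, negMulLog (∑ x, q x y) := by
  set r : S → ℝ := fun x => ∑ y, q x y with hr
  set s : T → ℝ := fun y => ∑ x, q x y with hs
  set t : ℝ := ∑ x, ∑ y, q x y with ht
  have hr0 : ∀ x, 0 ≤ r x := fun x => Finset.sum_nonneg fun y _ => hq x y
  have hs0 : ∀ y, 0 ≤ s y := fun y => Finset.sum_nonneg fun x _ => hq x y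
  have ht0 : 0 ≤ t := Finset.sum_nonneg fun x _ => hr0 x
  have hqr : ∀ x y, q x y ≤ r x := fun x y =>
    Finset.single_le_sum (fun y _ => hq x y) (Finset.mem_univ y)
  have hqs : ∀ x y, q x y ≤ s y := fun x y =>
    Finset.single_le_sum (f := fun x => q x y) (fun x _ => hq x y) (Finset.mem_univ x)
  have hrt : ∀ x, r x ≤ t := fun x =>
    Finset.single_le_sum (fun x _ => hr0 x) (Finset.mem_univ x)
  have hst : ∑ y, s y = t := Finset.sum_comm
  have hterm : ∀ x y, q x y - r x * s y / t ≤
      q x y * (log (q x y) + log t - log (r x) - log (s y)) := by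
    intro x y
    rcases (hq x y).eq_or_lt with h | h
    · rw [← h]
      have := div_nonneg (mul_nonneg (hr0 x) (hs0 y)) ht0
      simpa using this
    · have hrp := h.trans_le (hqr x y)
      have hsp := h.trans_le (hqs x y)
      have htp := hrp.trans_le (hrt x)
      have key := log_le_sub_one_of_pos (x := r x * s y / (q x y * t)) (by positivity)
      rw [log_div (by positivity) (by positivity), log_mul hrp.ne' hsp.ne',
        log_mul h.ne' htp.ne'] at key
      have e : r x * s y / t = q x y * (r x * s y / (q x y * t)) := by field_simp
      rw [e]
      nlinarith
  have htotal : ∑ x, ∑ y, (q x y - r x * s y / t) = 0 := by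
    simp only [Finset.sum_sub_distrib, ← Finset.sum_div, ← Finset.mul_sum, hst]
    rw [← Finset.sum_mul, ← ht, mul_self_div_self, sub_self]
  have hexpand : ∑ x, ∑ y, q x y * (log (q x y) + log t - log (r x) - log (s y)) =
      ∑ x, negMulLog (r x) + ∑ y, negMulLog (s y) -
        (∑ x, ∑ y, negMulLog (q x y) + negMulLog t) := by
    have h1 : ∑ x, ∑ y, q x y * log (r x) = ∑ x, r x * log (r x) := by
      simp only [← Finset.sum_mul, hr]
    have h2 : ∑ x, ∑ y, q x y * log (s y) = ∑ y, s y * log (s y) := by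
      rw [Finset.sum_comm]; simp only [← Finset.sum_mul, hs]
    have h3 : ∑ x, ∑ y, q x y * log t = t * log t := by
      simp only [← Finset.sum_mul, ht]
    simp only [negMulLog_eq_neg, mul_sub, mul_add, Finset.sum_sub_distrib, Finset.sum_add_distrib,
      Finset.sum_neg_distrib, h1, h2, h3]
    ring
  have := Finset.sum_le_sum fun x (_ : x ∈ Finset.univ) =>
    Finset.sum_le_sum fun y (_ : y ∈ Finset.univ) => hterm x y
  rw [htotal, hexpand] at this
  linarith

theorem sum_pr_prodMk [IsFiniteMeasure μ] {T : Type*} [MeasurableSpace S]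
    [MeasurableSingletonClass S] {X : Ω → S} (hX : Measurable X) (Y : Ω → T) (y : T) :
    ∑ x, pr μ (fun ω => (X ω, Y ω)) (x, y) = pr μ Y y := by
  have h := sum_measure_preimage_singleton (μ := μ.restrict (Y ⁻¹' {y})) (f := X) Finset.univ
    (fun x _ => hX (measurableSet_singleton x))
  simp only [Measure.restrict_apply (hX (measurableSet_singleton _)), Finset.coe_univ,
    Set.preimage_univ, Measure.restrict_apply_univ] at h
  unfold pr
  rw [← h, ENNReal.toReal_sum fun x _ => measure_ne_top _ _]
  refine Finset.sum_congr rfl fun x _ => ?_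
  congr 2
  ext ω
  simp

variable [MeasurableSpace S] [MeasurableSingletonClass S]
  [MeasurableSpace T] [MeasurableSingletonClass T]

/-- Strong subadditivity of entropy. -/
theorem cmi_nonneg [IsFiniteMeasure μ] {X : Ω → S} {Y : Ω → T} (hX : Measurable X)
    (hY : Measurable Y) (Z : Ω → U) : 0 ≤ cmi μ X Y Z := by
  have hXZ : ∀ x z, ∑ y, pr μ (fun ω => (X ω, (Y ω, Z ω))) (x, (y, z)) =
      pr μ (fun ω => (X ω, Z ω)) (x, z) := fun x z => by
    rw [← sum_pr_prodMk hY (fun ω => (X ω, Z ω))]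
    refine Finset.sum_congr rfl fun y _ => ?_
    unfold pr
    congr 2
    ext ω
    simp only [Set.mem_preimage, Set.mem_singleton_iff, Prod.mk.injEq]
    tauto
  have key := Finset.sum_le_sum fun z (_ : z ∈ Finset.univ) =>
    sum_negMulLog_marginals (fun x y => pr μ (fun ω => (X ω, (Y ω, Z ω))) (x, (y, z)))
      (fun x y => ENNReal.toReal_nonneg)
  simp only [sum_pr_prodMk hX, hXZ, Finset.sum_add_distrib] at key
  have hXYZ : ∑ z, ∑ x, ∑ y, negMulLog (pr μ (fun ω => (X ω, (Y ω, Z ω))) (x, (y, z))) =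
      ∑ w, negMulLog (pr μ (fun ω => (X ω, (Y ω, Z ω))) w) := by
    simp only [Fintype.sum_prod_type]
    rw [Finset.sum_comm]
    exact Finset.sum_congr rfl fun x _ => Finset.sum_comm
  rw [hXYZ, Finset.sum_comm (s := Finset.univ (α := U)) (t := Finset.univ (α := S)),
    Finset.sum_comm (s := Finset.univ (α := U)) (t := Finset.univ (α := T)),
    ← Fintype.sum_prod_type', ← Fintype.sum_prod_type'] at key
  unfold cmi ent
  rw [← add_div, ← sub_div, ← sub_div]
  exact div_nonneg (by linarith) (log_nonneg one_le_two)

/-- Monotonicity of entropy. -/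
theorem condEnt_nonneg [IsFiniteMeasure μ] {T : Type*} [Fintype T] {X : Ω → S}
    (hX : Measurable X) (Y : Ω → T) :
    0 ≤ condEnt μ X Y := by
  have h := cmi_nonneg (μ := μ) hX hX Y
  have e := ent_comp_of_injective (μ := μ) (fun ω => (X ω, Y ω)) (f := fun p => (p.1, p))
    fun p q h => (Prod.ext_iff.1 h).2
  unfold cmi at h
  unfold condEnt
  simp only at e
  linarith

theorem cmi_eq_zero_of_condEnt_left [IsFiniteMeasure μ] {A : Ω → S} {B : Ω → T} {X : Ω → U}
    (hA : Measurable A) (hB : Measurable B) (h : condEnt μ A X = 0) : cmi μ A B X = 0 := by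
  have h1 := condEnt_nonneg (μ := μ) hA (fun ω => (B ω, X ω))
  refine le_antisymm ?_ (cmi_nonneg hA hB X)
  unfold cmi condEnt at *
  linarith

theorem cmi_eq_zero_of_condEnt_right [IsFiniteMeasure μ] {A : Ω → S} {B : Ω → T} {X : Ω → U}
    (hA : Measurable A) (hB : Measurable B) (h : condEnt μ B X = 0) : cmi μ A B X = 0 :=
  (cmi_comm A B X).trans (cmi_eq_zero_of_condEnt_left hB hA h)

variable [MeasurableSpace U] [MeasurableSingletonClass U]
  [MeasurableSpace R] [MeasurableSingletonClass R]
  [IsFiniteMeasure μ] {A : Ω → R} {B : Ω → S} {C : Ω → T} {X : Ω → U}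

theorem condEnt_le_add_cmi (hA : Measurable A) (hB : Measurable B) (hC : Measurable C)
    (hX : Measurable X) :
    condEnt μ X C ≤ condEnt μ X A + condEnt μ X B + cmi μ A B C := by
  have h1 := cmi_nonneg (μ := μ) hA hB (fun ω => (X ω, C ω))
  have h2 := condEnt_nonneg (μ := μ) hX (fun ω => (A ω, (B ω, C ω)))
  have h3 := cmi_nonneg (μ := μ) hX hC A
  have h4 := cmi_nonneg (μ := μ) hX hC B
  have e1 := ent_quadruple_rotate (μ := μ) A B C X
  have e2 := ent_quadruple_swap_right (μ := μ) A B X C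
  have e3 := ent_triple_rotate (μ := μ) X C A
  have e4 := ent_triple_rotate (μ := μ) X C B
  have e5 := ent_pair_comm (μ := μ) C A
  have e6 := ent_pair_comm (μ := μ) C B
  unfold cmi condEnt at *
  linarith

theorem cmi_le_cmi_add_cmi_add_condEnt (hA : Measurable A) (hB : Measurable B)
    (hC : Measurable C) (hX : Measurable X) :
    cmi μ B C X ≤ cmi μ A B X + cmi μ B C A + condEnt μ X A := by
  have h1 := cmi_nonneg (μ := μ) hA hB (fun ω => (C ω, X ω))
  have h2 := condEnt_nonneg (μ := μ) hX (fun ω => (A ω, (B ω, C ω)))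
  have h3 := cmi_nonneg (μ := μ) hX hC A
  have h4 := cmi_nonneg (μ := μ) hX hB A
  have e1 := ent_quadruple_rotate (μ := μ) A B C X
  have e2 := ent_triple_rotate (μ := μ) B C A
  have e3 := ent_triple_rotate (μ := μ) X C A
  have e4 := ent_triple_rotate (μ := μ) X B A
  have e5 := ent_triple_left_comm (μ := μ) B C X
  have e6 := ent_quadruple_swap_right (μ := μ) A B C X
  have e7 := ent_pair_comm (μ := μ) X A
  have e8 := ent_pair_comm (μ := μ) X C
  have e9 : ent μ (fun ω => (A ω, (X ω, C ω))) = ent μ (fun ω => (A ω, (C ω, X ω))) :=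
    (ent_triple_rotate A X C).trans (ent_triple_left_comm C A X)
  have e10 : ent μ (fun ω => (A ω, (X ω, B ω))) = ent μ (fun ω => (A ω, (B ω, X ω))) :=
    (ent_triple_rotate A X B).trans (ent_triple_left_comm B A X)
  unfold cmi condEnt at *
  linarith

theorem IsCommonInfo.step (h : IsCommonInfo μ A B X) (hres : RES3 μ A B C)
    (hA : Measurable A) (hB : Measurable B) (hC : Measurable C) (hX : Measurable X) :
    IsCommonInfo μ B C X := by
  obtain ⟨h1, h2, h3⟩ := h
  obtain ⟨r1, r2, -⟩ := hres
  have i1 := cmi_le_cmi_add_cmi_add_condEnt (μ := μ) hA hB hC hX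
  have i2 := condEnt_le_add_cmi (μ := μ) hA hB hC hX
  exact ⟨le_antisymm (by linarith) (cmi_nonneg hB hC X), h3,
    le_antisymm (by linarith) (condEnt_nonneg hX C)⟩

theorem IsCommonInfo.condEnt_eq_zero (h : IsCommonInfo μ A B X) (hA : Measurable A)
    (hB : Measurable B) (hC : Measurable C) (hX : Measurable X) (hAB : cmi μ A B C = 0) :
    condEnt μ X C = 0 := by
  have := condEnt_le_add_cmi (μ := μ) hA hB hC hX
  exact le_antisymm (by linarith [h.2.1, h.2.2]) (condEnt_nonneg hX C)

theorem IsCommonInfo.res3 (h : IsCommonInfo μ A B X) (hA : Measurable A) (hB : Measurable B)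
    (hX : Measurable X) : RES3 μ A B X :=
  ⟨h.1, cmi_eq_zero_of_condEnt_right hB hX h.2.1, cmi_eq_zero_of_condEnt_left hX hA h.2.2⟩

end Shannon

section Transfer

variable {Ω : Type*} [MeasurableSpace Ω] {μ : Measure Ω} {Ω' : Type*} [MeasurableSpace Ω']
  {ν : Measure Ω'} {R S T V : Type*} [Fintype R] [Fintype S] [Fintype T] [Finite V]
  [MeasurableSpace V] [MeasurableSingletonClass V] {X : Ω → V} {X' : Ω' → V}

theorem ent_congr_of_identDistrib (h : IdentDistrib X X' μ ν) (f : V → S) :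
    ent μ (fun ω => f (X ω)) = ent ν (fun ω => f (X' ω)) := by
  unfold ent pr
  congr 1
  refine Finset.sum_congr rfl fun x _ => ?_
  congr 2
  exact h.measure_mem_eq (s := f ⁻¹' {x}) (Set.toFinite _).measurableSet

theorem condEnt_congr_of_identDistrib (h : IdentDistrib X X' μ ν) (f : V → R) (g : V → S) :
    condEnt μ (fun ω => f (X ω)) (fun ω => g (X ω)) =
      condEnt ν (fun ω => f (X' ω)) (fun ω => g (X' ω)) := by
  unfold condEnt
  rw [ent_congr_of_identDistrib h g, ent_congr_of_identDistrib h fun v => (f v, g v)]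

theorem cmi_congr_of_identDistrib (h : IdentDistrib X X' μ ν) (f : V → R) (g : V → S)
    (k : V → T) :
    cmi μ (fun ω => f (X ω)) (fun ω => g (X ω)) (fun ω => k (X ω)) =
      cmi ν (fun ω => f (X' ω)) (fun ω => g (X' ω)) (fun ω => k (X' ω)) := by
  unfold cmi
  rw [ent_congr_of_identDistrib h k, ent_congr_of_identDistrib h fun v => (f v, k v),
    ent_congr_of_identDistrib h fun v => (g v, k v),
    ent_congr_of_identDistrib h fun v => (f v, (g v, k v))]

theorem isCommonInfo_iff_of_identDistrib (h : IdentDistrib X X' μ ν) (f : V → R) (g : V → S)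
    (k : V → T) :
    IsCommonInfo μ (fun ω => f (X ω)) (fun ω => g (X ω)) (fun ω => k (X ω)) ↔
      IsCommonInfo ν (fun ω => f (X' ω)) (fun ω => g (X' ω)) (fun ω => k (X' ω)) := by
  unfold IsCommonInfo
  rw [cmi_congr_of_identDistrib h, condEnt_congr_of_identDistrib h,
    condEnt_congr_of_identDistrib h]

/-- A finite-valued random variable has a copy on a probability space in `Type`. -/
theorem exists_probSpace_identDistrib [IsProbabilityMeasure μ] (hX : Measurable X) :
    ∃ (P : ProbSpace) (X' : P.carrier → V), Measurable X' ∧ IdentDistrib X X' μ P.μ := by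
  obtain ⟨n, ⟨e⟩⟩ := Finite.exists_equiv_fin V
  have he : Measurable e := measurable_of_countable e
  have hes : Measurable e.symm := measurable_of_countable e.symm
  have : IsProbabilityMeasure (μ.map fun ω => e (X ω)) :=
    Measure.isProbabilityMeasure_map (he.comp hX).aemeasurable
  refine ⟨⟨Fin n, μ.map fun ω => e (X ω)⟩, e.symm, hes, hX.aemeasurable, hes.aemeasurable, ?_⟩
  refine Eq.trans ?_ (Measure.map_map hes (he.comp hX)).symm
  congr 1
  ext ω
  simp

end Transfer

/-- the EQRES characterization. -/
theorem stmt_17 {Ω : Type*} [MeasurableSpace Ω] (μ : Measure Ω) [IsProbabilityMeasure μ]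
    {SY₁ SZ₁ SY₂ SZ₂ SX₁ SX₂ : Type*}
    [Fintype SY₁] [Fintype SZ₁] [Fintype SY₂] [Fintype SZ₂] [Fintype SX₁] [Fintype SX₂]
    [MeasurableSpace SY₁] [MeasurableSingletonClass SY₁]
    [MeasurableSpace SZ₁] [MeasurableSingletonClass SZ₁]
    [MeasurableSpace SY₂] [MeasurableSingletonClass SY₂]
    [MeasurableSpace SZ₂] [MeasurableSingletonClass SZ₂]
    [MeasurableSpace SX₁] [MeasurableSingletonClass SX₁]
    [MeasurableSpace SX₂] [MeasurableSingletonClass SX₂]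
    (Y₁ : Ω → SY₁) (Z₁ : Ω → SZ₁) (Y₂ : Ω → SY₂) (Z₂ : Ω → SZ₂)
    (X₁ : Ω → SX₁) (X₂ : Ω → SX₂)
    (hY₁ : Measurable Y₁) (hZ₁ : Measurable Z₁) (hY₂ : Measurable Y₂)
    (hZ₂ : Measurable Z₂) (hX₁ : Measurable X₁) (hX₂ : Measurable X₂)
    (hres₁ : cmi μ Y₁ Z₁ X₁ = 0 ∧ condEnt μ X₁ Y₁ = 0 ∧ condEnt μ X₁ Z₁ = 0)
    (hres₂ : cmi μ Y₂ Z₂ X₂ = 0 ∧ condEnt μ X₂ Y₂ = 0 ∧ condEnt μ X₂ Z₂ = 0) :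
    (∃ (P : ProbSpace) (Y₁' : P.carrier → SY₁) (Z₁' : P.carrier → SZ₁)
      (Y₂' : P.carrier → SY₂) (Z₂' : P.carrier → SZ₂)
      (X₁' : P.carrier → SX₁) (X₂' : P.carrier → SX₂)
      (T₁ T₂ : FinAlphabet) (U₁ : P.carrier → T₁.carrier) (U₂ : P.carrier → T₂.carrier),
      Measurable Y₁' ∧ Measurable Z₁' ∧ Measurable Y₂' ∧ Measurable Z₂' ∧
      Measurable X₁' ∧ Measurable X₂' ∧ Measurable U₁ ∧ Measurable U₂ ∧
      IdentDistrib (fun ω => (Y₁ ω, Z₁ ω, Y₂ ω, Z₂ ω, X₁ ω, X₂ ω))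
        (fun ω => (Y₁' ω, Z₁' ω, Y₂' ω, Z₂' ω, X₁' ω, X₂' ω)) μ P.μ ∧
      RES3 P.μ Y₁' Z₁' U₁ ∧ RES3 P.μ Z₁' U₁ U₂ ∧
      RES3 P.μ U₁ U₂ Y₂' ∧ RES3 P.μ U₂ Y₂' Z₂') ↔
    (condEnt μ X₁ X₂ = 0 ∧ condEnt μ X₂ X₁ = 0) := by
  constructor
  · rintro ⟨P, Y₁', Z₁', Y₂', Z₂', X₁', X₂', T₁, T₂, U₁, U₂, mY₁, mZ₁, mY₂, mZ₂, mX₁, mX₂, mU₁, mU₂,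
      hid, r₁, r₂, r₃, r₄⟩
    have c₁ := (isCommonInfo_iff_of_identDistrib hid (fun v => v.1) (fun v => v.2.1)
      (fun v => v.2.2.2.2.1)).1 hres₁
    have c₂ := (isCommonInfo_iff_of_identDistrib hid (fun v => v.2.2.1) (fun v => v.2.2.2.1)
      (fun v => v.2.2.2.2.2)).1 hres₂
    have c : IsCommonInfo P.μ Y₂' Z₂' X₁' :=
      (((IsCommonInfo.step c₁ r₁ mY₁ mZ₁ mU₁ mX₁).step r₂ mZ₁ mU₁ mU₂ mX₁).step r₃
        mU₁ mU₂ mY₂ mX₁).step r₄ mU₂ mY₂ mZ₂ mX₁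
    exact ⟨(condEnt_congr_of_identDistrib hid (fun v => v.2.2.2.2.1) (fun v => v.2.2.2.2.2)).trans
        (c.condEnt_eq_zero mY₂ mZ₂ mX₂ mX₁ c₂.1),
      (condEnt_congr_of_identDistrib hid (fun v => v.2.2.2.2.2) (fun v => v.2.2.2.2.1)).trans
        (IsCommonInfo.condEnt_eq_zero c₂ mY₂ mZ₂ mX₁ mX₂ c.1)⟩
  · rintro ⟨h₁₂, h₂₁⟩
    obtain ⟨P, W, mW, hid⟩ := exists_probSpace_identDistrib (μ := μ)
      (X := fun ω => (Y₁ ω, Z₁ ω, Y₂ ω, Z₂ ω, X₁ ω, X₂ ω)) (by fun_prop)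
    obtain ⟨n₁, ⟨e₁⟩⟩ := Finite.exists_equiv_fin SX₁
    obtain ⟨n₂, ⟨e₂⟩⟩ := Finite.exists_equiv_fin SX₂
    have me₁ : Measurable e₁ := measurable_of_countable e₁
    have me₂ : Measurable e₂ := measurable_of_countable e₂
    have mY₁ : Measurable fun ω => (W ω).1 := by fun_prop
    have mZ₁ : Measurable fun ω => (W ω).2.1 := by fun_prop
    have mY₂ : Measurable fun ω => (W ω).2.2.1 := by fun_prop
    have mZ₂ : Measurable fun ω => (W ω).2.2.2.1 := by fun_prop
    have mX₁ : Measurable fun ω => (W ω).2.2.2.2.1 := by fun_prop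
    have mX₂ : Measurable fun ω => (W ω).2.2.2.2.2 := by fun_prop
    have mU₁ : Measurable fun ω => e₁ (W ω).2.2.2.2.1 := me₁.comp mX₁
    have mU₂ : Measurable fun ω => e₂ (W ω).2.2.2.2.2 := me₂.comp mX₂
    have c₁ := ((isCommonInfo_iff_of_identDistrib hid (fun v => v.1) (fun v => v.2.1)
      (fun v => v.2.2.2.2.1)).1 hres₁).comp e₁.injective
    have c₂ := ((isCommonInfo_iff_of_identDistrib hid (fun v => v.2.2.1) (fun v => v.2.2.2.1)
      (fun v => v.2.2.2.2.2)).1 hres₂).comp e₂.injective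
    rw [condEnt_congr_of_identDistrib hid (fun v => v.2.2.2.2.1) (fun v => v.2.2.2.2.2),
      ← condEnt_comp_left e₁.injective, ← condEnt_comp_right e₂.injective] at h₁₂
    rw [condEnt_congr_of_identDistrib hid (fun v => v.2.2.2.2.2) (fun v => v.2.2.2.2.1),
      ← condEnt_comp_left e₂.injective, ← condEnt_comp_right e₁.injective] at h₂₁
    have r₄ := c₂.res3 mY₂ mZ₂ mU₂
    exact ⟨P, _, _, _, _, _, _, ⟨Fin n₁⟩, ⟨Fin n₂⟩, fun ω => e₁ (W ω).2.2.2.2.1,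
      fun ω => e₂ (W ω).2.2.2.2.2, mY₁, mZ₁, mY₂, mZ₂, mX₁, mX₂, mU₁, mU₂, hid,
      c₁.res3 mY₁ mZ₁ mU₁,
      ⟨cmi_eq_zero_of_condEnt_right mZ₁ mU₁ h₁₂, cmi_eq_zero_of_condEnt_left mU₁ mU₂ c₁.2.2,
        cmi_eq_zero_of_condEnt_left mU₂ mZ₁ h₂₁⟩,
      ⟨cmi_eq_zero_of_condEnt_right mU₁ mU₂ c₂.2.1, cmi_eq_zero_of_condEnt_left mU₂ mY₂ h₂₁,
        cmi_eq_zero_of_condEnt_right mY₂ mU₁ h₁₂⟩,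
      r₄.2.2, r₄.1, r₄.2.1⟩

end CIPaper
end
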